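/- Let 0 < ς < 1. There exists a constant C_ς > 0, depending only on ς, such that for every nonincreasing sequence (δ_j)_{j≥1} of nonnegative real numbers with ∑_{j≥1} δ_j^ς < ∞, and every integer s ≥ 1, one has ∑_{j≥s+1} δ_j ≤ C_ς s^{1-1/ς} (∑_{j≥1} δ_j^ς)^{1/ς} (Stechkin's inequality). -/

import Mathlib

/-- The `s`-th and later terms of a nonincreasing sequence are at most the mean of its sum. -/
lemma Antitone.le_tsum_div {b : ℕ → ℝ} (hb : Antitone b) (hb0 : ∀ n, 0 ≤ b n)
    (hsum : Summable b) {s n : ℕ} (hs : 1 ≤ s) (hn : s ≤ n) : b n ≤ (∑' i, b i) / s := by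
  rw [le_div_iff₀ (by exact_mod_cast hs), mul_comm]
  calc (s : ℝ) * b n = ∑ _i ∈ Finset.range s, b n := by simp
    _ ≤ ∑ i ∈ Finset.range s, b i :=
        Finset.sum_le_sum fun i hi => hb ((Finset.mem_range.1 hi).le.trans hn)
    _ ≤ ∑' i, b i := hsum.sum_le_tsum _ fun i _ => hb0 i

/-- Stechkin's inequality with constant `1`, for sequences indexed from `0`. -/
lemma Antitone.tsum_tail_le_rpow {a : ℕ → ℝ} (ha : Antitone a) (ha0 : ∀ n, 0 ≤ a n) {p : ℝ}
    (hp0 : 0 < p) (hp1 : p < 1) (hsum : Summable fun n => a n ^ p) {s : ℕ} (hs : 1 ≤ s) :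
    ∑' n, a (n + s) ≤ (s : ℝ) ^ (1 - 1 / p) * (∑' n, a n ^ p) ^ (1 / p) := by
  set S := ∑' n, a n ^ p with hS
  have hb0 (n : ℕ) : 0 ≤ a n ^ p := Real.rpow_nonneg (ha0 n) p
  have hb : Antitone fun n => a n ^ p := fun m n h => Real.rpow_le_rpow (ha0 n) (ha h) hp0.le
  have hS0 : 0 ≤ S := tsum_nonneg hb0
  have hs0 : (0 : ℝ) < s := by exact_mod_cast hs
  have he : 0 < 1 / p - 1 := by
    rw [sub_pos]
    exact one_lt_one_div hp0 hp1
  set M := (S / s) ^ (1 / p - 1) with hM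
  have hM0 : 0 ≤ M := Real.rpow_nonneg (div_nonneg hS0 hs0.le) _
  have hle (n : ℕ) : a (n + s) ≤ a (n + s) ^ p * M := by
    calc a (n + s) = a (n + s) ^ p * (a (n + s) ^ p) ^ (1 / p - 1) := by
          rw [← Real.rpow_mul (ha0 _), ← Real.rpow_add_of_nonneg (ha0 _) hp0.le
            (mul_nonneg hp0.le he.le)]
          have : p + p * (1 / p - 1) = 1 := by field_simp; ring
          rw [this, Real.rpow_one]
      _ ≤ a (n + s) ^ p * M := by
          refine mul_le_mul_of_nonneg_left ?_ (hb0 _)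
          exact Real.rpow_le_rpow (hb0 _)
            (hb.le_tsum_div hb0 hsum hs (Nat.le_add_left s n)) he.le
  have htail : Summable fun n => a (n + s) ^ p := (summable_nat_add_iff s).2 hsum
  have hmaj : Summable fun n => a (n + s) ^ p * M := htail.mul_right M
  calc ∑' n, a (n + s) ≤ ∑' n, a (n + s) ^ p * M :=
        (Summable.of_nonneg_of_le (fun n => ha0 _) hle hmaj).tsum_le_tsum hle hmaj
    _ = (∑' n, a (n + s) ^ p) * M := tsum_mul_right
    _ ≤ S * M := by
        refine mul_le_mul_of_nonneg_right ?_ hM0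
        rw [hS, ← hsum.sum_add_tsum_nat_add s]
        exact le_add_of_nonneg_left (Finset.sum_nonneg fun i _ => hb0 i)
    _ = (s : ℝ) ^ (1 - 1 / p) * S ^ (1 / p) := by
        have h : S ^ (1 / p) = S * S ^ (1 / p - 1) := by
          rw [← Real.rpow_one_add' hS0 (by simpa using hp0.ne')]
          congr 1
          ring
        rw [hM, Real.div_rpow hS0 hs0.le, h, ← neg_sub (1 / p) 1, Real.rpow_neg hs0.le]
        ring


/-- Stechkin's inequality. Sequences are indexed so that `δ (j+1)` represents the
`j`-th term `δ_j`, `j ≥ 1`. -/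
theorem stmt_5 {ς : ℝ} (hς0 : 0 < ς) (hς1 : ς < 1) :
    ∃ C : ℝ, 0 < C ∧
      ∀ δ : ℕ → ℝ, (∀ j, 1 ≤ j → 0 ≤ δ j) → (∀ j, 1 ≤ j → δ (j + 1) ≤ δ j) →
        Summable (fun j : ℕ => δ (j + 1) ^ ς) →
        ∀ s : ℕ, 1 ≤ s →
          (∑' j : ℕ, δ (j + s + 1)) ≤
            C * (s : ℝ) ^ (1 - 1 / ς) * (∑' j : ℕ, δ (j + 1) ^ ς) ^ (1 / ς) := by
  refine ⟨1, one_pos, fun δ h0 hanti hsum s hs => ?_⟩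
  have ha : Antitone fun n => δ (n + 1) :=
    antitone_nat_of_succ_le fun n => hanti (n + 1) (Nat.le_add_left 1 n)
  rw [one_mul]
  exact ha.tsum_tail_le_rpow (fun n => h0 (n + 1) (Nat.le_add_left 1 n)) hς0 hς1 hsum hs
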